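/- Let α₀, α₁ ∈ C^∞(ℝ³), ψ ∈ C^∞(ℝ × ℝ³), and let φ ∈ C^∞(ℝ × ℝ³) satisfy ∂_t²φ − Δφ = ψ on [0,∞) × ℝ³ with φ(0,·) = α₀ and ∂_tφ(0,·) = α₁. Then for every t > 0 and x ∈ ℝ³: φ(t,x) = (1/(4π)) ∫_{B(x,t)} ψ(t − |y − x|, y)/|y − x| dy + (1/(4πt²)) ∫_{∂B(x,t)} [ t·α₁(y) + α₀(y) + (y − x)·∇α₀(y) ] dσ(y). -/

import Mathlib

open MeasureTheory Metric Real
open scoped RealInnerProductSpace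

noncomputable section

abbrev E3 := EuclideanSpace ℝ (Fin 3)

/-- The surface measure on the unit sphere `S² ⊆ ℝ³` (total mass `4π`). -/
def sphMeasure : Measure (sphere (0 : E3) 1) := (volume : Measure E3).toSphere

/-- Laplacian of `f : ℝ³ → ℝ`. -/
def lap (f : E3 → ℝ) (x : E3) : ℝ :=
  ∑ i : Fin 3,
    fderiv ℝ (fun y => fderiv ℝ f y (EuclideanSpace.single i (1:ℝ))) x
      (EuclideanSpace.single i (1:ℝ))

/-- Surface integral `∫_{∂B(x,r)} f dσ`, written in the spherical parametrization
`y = x + r ω`, `ω ∈ S²`, with area element `r² dσ(ω)`. -/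
def sphereIntegral (x : E3) (r : ℝ) (f : E3 → ℝ) : ℝ :=
  r ^ 2 * ∫ ω : sphere (0 : E3) 1, f (x + r • (ω : E3)) ∂sphMeasure

/-- Time derivative `∂_t φ`. -/
def dt (φ : ℝ × E3 → ℝ) (q : ℝ × E3) : ℝ := deriv (fun s => φ (s, q.2)) q.1

instance sphMeasure_fin : IsFiniteMeasure sphMeasure := by
  unfold sphMeasure; infer_instance

lemma sph_mass : sphMeasure.real Set.univ = 4 * π := by
  unfold sphMeasure
  rw [Measure.toSphere_real_apply_univ, measureReal_def, EuclideanSpace.volume_ball_fin_three]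
  have : (0:ℝ) ≤ π * 4 / 3 := by positivity
  simp [ENNReal.toReal_ofReal this]
  ring

lemma sph_integrable {g : E3 → ℝ} (hg : Continuous g) :
    Integrable (fun ω : sphere (0 : E3) 1 => g ω) sphMeasure := by
  have : Continuous (fun ω : sphere (0 : E3) 1 => g ω) := hg.comp continuous_subtype_val
  exact this.integrable_of_hasCompactSupport (HasCompactSupport.of_compactSpace _)

lemma sph_diff (F F' : ℝ → E3 → ℝ) (hF : Continuous (Function.uncurry F))
    (hF' : Continuous (Function.uncurry F'))
    (hd : ∀ r y, HasDerivAt (fun r => F r y) (F' r y) r) (r : ℝ) :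
    HasDerivAt (fun r => ∫ ω : sphere (0 : E3) 1, F r ω ∂sphMeasure)
      (∫ ω : sphere (0 : E3) 1, F' r ω ∂sphMeasure) r := by
  have hK : IsCompact (closedBall r 1 ×ˢ sphere (0 : E3) 1) :=
    (isCompact_closedBall r 1).prod (isCompact_sphere _ _)
  obtain ⟨C, hC⟩ := hK.exists_bound_of_continuousOn hF'.continuousOn
  have h1 : ∀ r, Continuous (F r) := fun r => hF.comp (by fun_prop : Continuous fun y => (r, y))
  have h2 : ∀ r, Continuous (F' r) := fun r => hF'.comp (by fun_prop : Continuous fun y => (r, y))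
  refine (hasDerivAt_integral_of_dominated_loc_of_deriv_le (bound := fun _ => C)
    (F' := fun r (ω : sphere (0 : E3) 1) => F' r ω) (F := fun r (ω : sphere (0 : E3) 1) => F r ω)
    (closedBall_mem_nhds r one_pos) (Filter.Eventually.of_forall fun r =>
      (sph_integrable (h1 r)).aestronglyMeasurable) (sph_integrable (h1 r))
      (sph_integrable (h2 r)).aestronglyMeasurable ?_ (integrable_const _) ?_).2
  · exact Filter.Eventually.of_forall fun ω s hs => hC (s, ω) ⟨hs, ω.2⟩
  · exact Filter.Eventually.of_forall fun ω s hs => hd s ω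

def sphHomeo (e : E3 ≃ₗᵢ[ℝ] E3) : sphere (0 : E3) 1 ≃ₜ sphere (0 : E3) 1 where
  toFun ω := ⟨e ω, by simp⟩
  invFun ω := ⟨e.symm ω, by simp⟩
  left_inv ω := by simp
  right_inv ω := by simp
  continuous_toFun := by fun_prop
  continuous_invFun := by fun_prop

lemma sph_inv (e : E3 ≃ₗᵢ[ℝ] E3) (g : E3 → ℝ) :
    ∫ ω : sphere (0 : E3) 1, g (e ω) ∂sphMeasure = ∫ ω : sphere (0 : E3) 1, g ω ∂sphMeasure := by
  have hmp : MeasurePreserving (sphHomeo e) sphMeasure sphMeasure := by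
    refine ⟨(sphHomeo e).continuous.measurable, ?_⟩
    ext s hs
    rw [Measure.map_apply (sphHomeo e).continuous.measurable hs]
    unfold sphMeasure
    rw [Measure.toSphere_apply' _ hs,
      Measure.toSphere_apply' _ ((sphHomeo e).continuous.measurable hs)]
    congr 1
    refine Eq.trans ?_ (e.measurePreserving.measure_preimage_equiv (f := e.toMeasurableEquiv) _)
    congr 1
    ext y
    simp only [Set.mem_smul, Set.mem_image, Set.mem_preimage]
    constructor
    · rintro ⟨a, ha, _, ⟨ω, hω, rfl⟩, rfl⟩
      exact ⟨a, ha, _, ⟨_, hω, rfl⟩, by simp [sphHomeo]⟩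
    · rintro ⟨a, ha, _, ⟨ω, hω, rfl⟩, h⟩
      refine ⟨a, ha, _, ⟨(sphHomeo e).symm ω, by simpa using hω, rfl⟩, ?_⟩
      apply e.injective
      rw [map_smul]
      simpa [sphHomeo] using h
  exact hmp.integral_comp (sphHomeo e).measurableEmbedding (fun ω => g ω)

lemma sph_skew (J : E3 →L[ℝ] E3) (hJ : ∀ u v : E3, ⟪J u, v⟫ = - ⟪u, J v⟫)
    (g : E3 → ℝ) (hg : ContDiff ℝ 1 g) :
    ∫ ω : sphere (0 : E3) 1, fderiv ℝ g ω (J ω) ∂sphMeasure = 0 := by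
  have hJs : J ∈ skewAdjoint (E3 →L[ℝ] E3) := by
    rw [skewAdjoint.mem_iff, ContinuousLinearMap.star_eq_adjoint]
    ext1 u
    refine ext_inner_right ℝ fun v => ?_
    rw [ContinuousLinearMap.adjoint_inner_left]
    simp [hJ]
  let _ : NormedAlgebra ℚ (E3 →L[ℝ] E3) := .restrictScalars ℚ ℝ _
  obtain ⟨R, hR⟩ : ∃ R : ℝ → (E3 →L[ℝ] E3), R = fun r => NormedSpace.exp (r • J) := ⟨_, rfl⟩
  have hR0 : R 0 = 1 := by
    rw [hR]; exact (congrArg NormedSpace.exp (zero_smul ℝ J)).trans NormedSpace.exp_zero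
  have hu : ∀ r : ℝ, R r ∈ unitary (E3 →L[ℝ] E3) := fun r => by
    rw [hR]; exact NormedSpace.exp_mem_unitary_of_mem_skewAdjoint (skewAdjoint.smul_mem r hJs)
  have hE : ∀ r : ℝ, HasDerivAt R (J * R r) r :=
    fun r => by rw [hR]; exact hasDerivAt_exp_smul_const' J r
  have hEc : Continuous R :=
    continuous_iff_continuousAt.2 fun r => (hE r).continuousAt
  have hgc := hg.continuous
  have hgc' := hg.continuous_fderiv (by norm_num)
  have hRc : Continuous (fun p : ℝ × E3 => R p.1 p.2) := by fun_prop
  have key := sph_diff (fun r y => g (R r y))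
    (fun r y => fderiv ℝ g (R r y) (J (R r y)))
    (hgc.comp hRc) ((hgc'.comp hRc).clm_apply (J.continuous.comp hRc))
    (fun r y => by
      have h1 := (hE r).clm_apply (hasDerivAt_const r y)
      simp only [map_zero, add_zero] at h1
      exact (hg.differentiable (by norm_num) _).hasFDerivAt.comp_hasDerivAt r h1) 0
  have hc : (fun r : ℝ => ∫ ω : sphere (0 : E3) 1, g (R r ω) ∂sphMeasure)
      = fun _ => ∫ ω : sphere (0 : E3) 1, g ω ∂sphMeasure := by
    ext r
    exact sph_inv (Unitary.linearIsometryEquiv ⟨_, hu r⟩) g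
  rw [hc] at key
  have := key.unique (hasDerivAt_const _ _)
  simpa [hR0] using this

abbrev ee (i : Fin 3) : E3 := EuclideanSpace.single i (1:ℝ)

def Jm (i j : Fin 3) : E3 →L[ℝ] E3 :=
  (EuclideanSpace.proj i : E3 →L[ℝ] ℝ).smulRight (ee j)
    - (EuclideanSpace.proj j : E3 →L[ℝ] ℝ).smulRight (ee i)

lemma Jm_apply (i j : Fin 3) (y : E3) : Jm i j y = y i • ee j - y j • ee i := rfl

lemma Jm_skew (i j : Fin 3) (u v : E3) : ⟪Jm i j u, v⟫ = - ⟪u, Jm i j v⟫ := by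
  simp only [Jm_apply, inner_sub_left, inner_sub_right, real_inner_smul_left,
    real_inner_smul_right, EuclideanSpace.inner_single_left, EuclideanSpace.inner_single_right]
  simp
  ring

lemma e3_decomp (y : E3) : y = y 0 • ee 0 + y 1 • ee 1 + y 2 • ee 2 := by
  ext i
  fin_cases i <;> simp

lemma sph_sq (ω : sphere (0 : E3) 1) : (ω : E3) 0 ^ 2 + (ω : E3) 1 ^ 2 + (ω : E3) 2 ^ 2 = 1 := by
  have h : ‖(ω : E3)‖ = 1 := by simp
  have h2 := EuclideanSpace.norm_sq_eq (ω : E3)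
  rw [h] at h2
  simp [Fin.sum_univ_three] at h2
  linarith

lemma alg_id (B : E3 →L[ℝ] E3 →L[ℝ] ℝ) (D : E3 →L[ℝ] ℝ) (y : E3)
    (hy : y 0 ^ 2 + y 1 ^ 2 + y 2 ^ 2 = 1) :
    (B (Jm 0 1 y) (Jm 0 1 y) + D (Jm 0 1 (Jm 0 1 y)))
    + (B (Jm 0 2 y) (Jm 0 2 y) + D (Jm 0 2 (Jm 0 2 y)))
    + (B (Jm 1 2 y) (Jm 1 2 y) + D (Jm 1 2 (Jm 1 2 y)))
    = (∑ i : Fin 3, B (ee i) (ee i)) - (B y y + 2 * D y) := by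
  have e1 : B y y = B (y 0 • ee 0 + y 1 • ee 1 + y 2 • ee 2)
    (y 0 • ee 0 + y 1 • ee 1 + y 2 • ee 2) := by rw [← e3_decomp]
  have e2 : D y = D (y 0 • ee 0 + y 1 • ee 1 + y 2 • ee 2) := by rw [← e3_decomp]
  rw [e1, e2]
  simp only [Fin.sum_univ_three, Jm_apply, map_sub, map_add, map_smul,
    FunLike.coe_sub, FunLike.coe_add, FunLike.coe_smul, Pi.sub_apply, Pi.add_apply, Pi.smul_apply, smul_eq_mul,
    PiLp.sub_apply, PiLp.smul_apply]
  simp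
  linear_combination (-(B (ee 0) (ee 0)) - B (ee 1) (ee 1) - B (ee 2) (ee 2)) * (1 - hy)

lemma sph_pair (f : E3 → ℝ) (hf : ContDiff ℝ 2 f) (J : E3 →L[ℝ] E3)
    (hJ : ∀ u v : E3, ⟪J u, v⟫ = - ⟪u, J v⟫) :
    ∫ ω : sphere (0 : E3) 1, (fderiv ℝ (fderiv ℝ f) ω (J ω) (J ω) + fderiv ℝ f ω (J (J ω)))
      ∂sphMeasure = 0 := by
  have h1 : ContDiff ℝ 1 (fderiv ℝ f) := hf.fderiv_right (by norm_num)
  have := sph_skew J hJ (fun y => fderiv ℝ f y (J y)) (h1.clm_apply J.contDiff)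
  rw [← this]
  congr 1
  ext ω
  have h2 := ((h1.differentiable (by norm_num) (ω : E3)).hasFDerivAt).clm_apply
    (J.hasFDerivAt (x := (ω : E3)))
  rw [h2.fderiv]
  simp [add_comm]

lemma sph_lap (f : E3 → ℝ) (hf : ContDiff ℝ 2 f) :
    ∫ ω : sphere (0 : E3) 1, ((∑ i : Fin 3, fderiv ℝ (fderiv ℝ f) ω (ee i) (ee i)) -
      (fderiv ℝ (fderiv ℝ f) ω ω ω + 2 * fderiv ℝ f ω ω)) ∂sphMeasure = 0 := by
  have h1 : ContDiff ℝ 1 (fderiv ℝ f) := hf.fderiv_right (by norm_num)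
  have hc := h1.continuous
  have hc2 := h1.continuous_fderiv (by norm_num)
  have hi : ∀ J : E3 →L[ℝ] E3, Integrable (fun ω : sphere (0 : E3) 1 =>
      (fderiv ℝ (fderiv ℝ f) ω (J ω) (J ω) + fderiv ℝ f ω (J (J ω)))) sphMeasure := fun J =>
    sph_integrable (g := fun y => fderiv ℝ (fderiv ℝ f) y (J y) (J y) + fderiv ℝ f y (J (J y)))
      (by fun_prop)
  rw [← integral_congr_ae (Filter.Eventually.of_forall fun ω => alg_id _ _ _ (sph_sq ω))]
  rw [integral_add (by exact (hi (Jm 0 1)).add (hi (Jm 0 2))) (hi _), integral_add (hi _) (hi _),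
    sph_pair f hf _ (Jm_skew _ _), sph_pair f hf _ (Jm_skew _ _), sph_pair f hf _ (Jm_skew _ _)]
  simp

lemma darboux (φ : ℝ × E3 → ℝ) (hφ : ContDiff ℝ 2 φ) (s r : ℝ) (hr : r ≠ 0) (x : E3) :
    ∫ ω : sphere (0 : E3) 1,
      (r * (∑ i : Fin 3, fderiv ℝ (fderiv ℝ φ) (s, x + r • (ω : E3)) (0, ee i) (0, ee i)) -
      (r * fderiv ℝ (fderiv ℝ φ) (s, x + r • (ω : E3)) (0, ω) (0, ω)
        + 2 * fderiv ℝ φ (s, x + r • (ω : E3)) (0, ω))) ∂sphMeasure = 0 := by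
  have h1 : ContDiff ℝ 1 (fderiv ℝ φ) := hφ.fderiv_right (by norm_num)
  let L : E3 →L[ℝ] ℝ × E3 := r • ContinuousLinearMap.inr ℝ ℝ E3
  have hA : ∀ y : E3, HasFDerivAt (fun y : E3 => ((s, x + r • y) : ℝ × E3)) L y := by
    intro y
    have : (fun y : E3 => ((s, x + r • y) : ℝ × E3)) = fun y => (s, x) + L y := by
      ext y <;> simp [L]
    rw [this]
    exact (L.hasFDerivAt).const_add _
  have hf : ContDiff ℝ 2 (fun y : E3 => φ (s, x + r • y)) := hφ.comp (by fun_prop)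
  have d1 : fderiv ℝ (fun y : E3 => φ (s, x + r • y))
      = fun y => (fderiv ℝ φ (s, x + r • y)).comp L := by
    ext1 y
    exact (((hφ.differentiable (by norm_num) _).hasFDerivAt).comp y (hA y)).fderiv
  have d2 : ∀ y u v, fderiv ℝ (fderiv ℝ (fun y : E3 => φ (s, x + r • y))) y u v
      = fderiv ℝ (fderiv ℝ φ) (s, x + r • y) (L u) (L v) := by
    intro y u v
    rw [d1]
    have := (((h1.differentiable (by norm_num) _).hasFDerivAt).comp y (hA y)).clm_comp
      (hasFDerivAt_const L y)
    have e := this.fderiv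
    simp only [Function.comp_def] at e
    rw [e]
    simp
  have hL : ∀ v, L v = r • ((0, v) : ℝ × E3) := fun v => by simp [L]
  have key := sph_lap _ hf
  have : ∀ ω : sphere (0 : E3) 1, (r * (∑ i : Fin 3, fderiv ℝ (fderiv ℝ φ) (s, x + r • (ω : E3)) (0, ee i) (0, ee i)) -
      (r * fderiv ℝ (fderiv ℝ φ) (s, x + r • (ω : E3)) (0, ω) (0, ω)
        + 2 * fderiv ℝ φ (s, x + r • (ω : E3)) (0, ω))) = r⁻¹ * ((∑ i : Fin 3, fderiv ℝ (fderiv ℝ (fun y : E3 => φ (s, x + r • y))) ω (ee i) (ee i)) -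
      (fderiv ℝ (fderiv ℝ (fun y : E3 => φ (s, x + r • y))) ω ω ω + 2 * fderiv ℝ (fun y : E3 => φ (s, x + r • y)) ω ω)) := by
    intro ω
    simp only [d2]
    rw [d1]
    simp only [hL, ContinuousLinearMap.comp_apply, map_smul, FunLike.coe_smul, Pi.smul_apply, smul_eq_mul,
      Fin.sum_univ_three]
    field_simp
  simp_rw [this]
  rw [integral_const_mul, key, mul_zero]

lemma hasF2 (φ : ℝ × E3 → ℝ) (hφ : ContDiff ℝ 2 φ) (q v : ℝ × E3) :
    HasFDerivAt (fun q => fderiv ℝ φ q v) ((fderiv ℝ (fderiv ℝ φ) q).flip v) q := by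
  have h1 : ContDiff ℝ 1 (fderiv ℝ φ) := hφ.fderiv_right (by norm_num)
  have := (ContinuousLinearMap.apply ℝ ℝ v).hasFDerivAt.comp q
    (h1.differentiable (by norm_num) q).hasFDerivAt
  exact this

lemma wave_pt (φ : ℝ × E3 → ℝ) (hφ : ContDiff ℝ 2 φ) (s : ℝ) (x : E3) :
    dt (dt φ) (s, x) - lap (fun y => φ (s, y)) x =
      fderiv ℝ (fderiv ℝ φ) (s, x) (1, 0) (1, 0) -
      ∑ i : Fin 3, fderiv ℝ (fderiv ℝ φ) (s, x) (0, ee i) (0, ee i) := by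
  have h1 : ContDiff ℝ 1 (fderiv ℝ φ) := hφ.fderiv_right (by norm_num)
  have hA : ∀ (s : ℝ) (y : E3), HasFDerivAt (fun y : E3 => ((s, y) : ℝ × E3))
    (ContinuousLinearMap.inr ℝ ℝ E3) y := fun s y => hasFDerivAt_prodMk_right s y
  have hB : ∀ (s : ℝ) (y : E3), HasDerivAt (fun s : ℝ => ((s, y) : ℝ × E3))
    (1, 0) s := fun s y => (hasDerivAt_id s).prodMk (hasDerivAt_const s y)
  have t1 : dt φ = fun q => fderiv ℝ φ q (1, 0) := by
    ext ⟨s, y⟩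
    exact ((hφ.differentiable (by norm_num) _).hasFDerivAt.comp_hasDerivAt s (hB s y)).deriv
  have t2 : dt (dt φ) (s, x) = fderiv ℝ (fderiv ℝ φ) (s, x) (1, 0) (1, 0) := by
    rw [t1]
    exact ((hasF2 φ hφ (s, x) (1, 0)).comp_hasDerivAt s (hB s x)).deriv
  have l1 : ∀ y, fderiv ℝ (fun y => φ (s, y)) y = (fderiv ℝ φ (s, y)).comp (ContinuousLinearMap.inr ℝ ℝ E3) := 
    fun y => ((hφ.differentiable (by norm_num) _).hasFDerivAt.comp y (hA s y)).fderiv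
  rw [t2]
  unfold lap
  congr 1
  refine Finset.sum_congr rfl fun i _ => ?_
  simp only [l1, ContinuousLinearMap.comp_apply, ContinuousLinearMap.inr_apply]
  have := ((hasF2 φ hφ (s, x) (0, ee i)).comp x (hA s x)).fderiv
  simp only [Function.comp_def] at this
  rw [this]
  rfl

lemma wave_char (φ ψ : ℝ × E3 → ℝ) (hφ : ContDiff ℝ 2 φ)
    (hwave : ∀ t : ℝ, 0 ≤ t → ∀ x : E3,
      dt (dt φ) (t, x) - lap (fun y => φ (t, y)) x = ψ (t, x)) (t : ℝ) (ht : 0 < t) (x : E3) :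
    4 * π * φ (t, x) = (∫ r in Set.Ioo 0 t, r * ∫ ω : sphere (0 : E3) 1,
        ψ (t - r, x + r • (ω : E3)) ∂sphMeasure)
      + ∫ ω : sphere (0 : E3) 1, (φ (0, x + t • (ω : E3))
        + t * fderiv ℝ φ (0, x + t • (ω : E3)) (1, ω)) ∂sphMeasure := by
  have h1 : ContDiff ℝ 1 (fderiv ℝ φ) := hφ.fderiv_right (by norm_num)
  have hc0 := hφ.continuous
  have hc1 := h1.continuous
  have hc2 := h1.continuous_fderiv (by norm_num)
  obtain ⟨K, hK⟩ : ∃ K : ℝ → E3 → ℝ, K = fun r y => φ (t - r, x + r • y)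
    + r * fderiv ℝ φ (t - r, x + r • y) (1, y) := ⟨_, rfl⟩
  obtain ⟨K', hK'⟩ : ∃ K' : ℝ → E3 → ℝ, K' = fun r y => fderiv ℝ φ (t - r, x + r • y) (-1, y)
    + (1 * fderiv ℝ φ (t - r, x + r • y) (1, y)
      + r * fderiv ℝ (fderiv ℝ φ) (t - r, x + r • y) (-1, y) (1, y)) := ⟨_, rfl⟩
  have hp : Continuous (fun q : ℝ × E3 => ((t - q.1, x + q.1 • q.2) : ℝ × E3)) := by fun_prop
  have hKc : Continuous (Function.uncurry K) := by
    rw [hK]; simp only [Function.uncurry_def]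
    exact (hc0.comp hp).add (continuous_fst.mul ((hc1.comp hp).clm_apply (by fun_prop)))
  have hKc' : Continuous (Function.uncurry K') := by
    rw [hK']; simp only [Function.uncurry_def]
    exact ((hc1.comp hp).clm_apply (by fun_prop)).add
      ((continuous_const.mul ((hc1.comp hp).clm_apply (by fun_prop))).add
      (continuous_fst.mul (((hc2.comp hp).clm_apply (by fun_prop)).clm_apply (by fun_prop))))
  have hd : ∀ r y, HasDerivAt (fun r => K r y) (K' r y) r := by
    intro r y
    rw [hK, hK']
    have hq : HasDerivAt (fun r : ℝ => ((t - r, x + r • y) : ℝ × E3)) (-1, y) r := by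
      refine HasDerivAt.prodMk ?_ ?_
      · simpa using (hasDerivAt_id r).const_sub t
      · simpa using ((hasDerivAt_id r).smul_const y).const_add x
    have a1 := (hφ.differentiable (by norm_num) (t - r, x + r • y)).hasFDerivAt.comp_hasDerivAt r hq
    have a2 := (hasF2 φ hφ (t - r, x + r • y) (1, y)).comp_hasDerivAt r hq
    exact a1.add ((hasDerivAt_id r).mul a2)
  have hG := sph_diff K K' hKc hKc' hd
  have hG'c : Continuous (fun r => ∫ ω : sphere (0 : E3) 1, K' r ω ∂sphMeasure) := by
    have := continuous_parametric_integral_of_continuous (μ := sphMeasure)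
      (f := fun r (ω : sphere (0 : E3) 1) => K' r ω)
      (hKc'.comp (by fun_prop : Continuous fun q : ℝ × sphere (0 : E3) 1 => (q.1, (q.2 : E3))))
      (isCompact_univ)
    simpa using this
  have ftc := intervalIntegral.integral_eq_sub_of_hasDerivAt (a := 0) (b := t)
    (fun r _ => hG r) (hG'c.intervalIntegrable _ _)
  rw [intervalIntegral.integral_of_le ht.le, integral_Ioc_eq_integral_Ioo] at ftc
  have e : ∀ r ∈ Set.Ioo 0 t, ∫ ω : sphere (0 : E3) 1, K' r ω ∂sphMeasure
      = -(r * ∫ ω : sphere (0 : E3) 1, ψ (t - r, x + r • (ω : E3)) ∂sphMeasure) := by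
    intro r hr
    have hda := darboux φ hφ (t - r) r hr.1.ne' x
    have hcr : Continuous (fun y : E3 => ((t - r, x + r • y) : ℝ × E3)) := by fun_prop
    have i1 : Integrable (fun ω : sphere (0 : E3) 1 => (r * (∑ i : Fin 3, fderiv ℝ (fderiv ℝ φ) (t - r, x + r • (ω : E3)) (0, ee i) (0, ee i)) -
      (r * fderiv ℝ (fderiv ℝ φ) (t - r, x + r • (ω : E3)) (0, ω) (0, ω)
        + 2 * fderiv ℝ φ (t - r, x + r • (ω : E3)) (0, ω)))) sphMeasure := by
      refine sph_integrable (g := fun y : E3 => (r * (∑ i : Fin 3, fderiv ℝ (fderiv ℝ φ) (t - r, x + r • y) (0, ee i) (0, ee i)) -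
      (r * fderiv ℝ (fderiv ℝ φ) (t - r, x + r • y) (0, y) (0, y)
        + 2 * fderiv ℝ φ (t - r, x + r • y) (0, y)))) ?_
      refine (continuous_const.mul (continuous_finsetSum _ fun i _ => ?_)).sub
        ((continuous_const.mul ?_).add (continuous_const.mul ?_))
      · exact ((hc2.comp hcr).clm_apply continuous_const).clm_apply continuous_const
      · exact ((hc2.comp hcr).clm_apply (by fun_prop)).clm_apply (by fun_prop)
      · exact (hc1.comp hcr).clm_apply (by fun_prop)
    have i2 : Integrable (fun ω : sphere (0 : E3) 1 => K' r ω) sphMeasure :=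
      sph_integrable (hKc'.comp (by fun_prop : Continuous fun y : E3 => (r, y)))
    rw [← integral_const_mul, ← integral_neg, ← add_zero (∫ ω : sphere (0 : E3) 1, K' r ω ∂sphMeasure), ← hda,
      ← integral_add i2 i1]
    congr 1
    ext ω
    rw [← hwave (t - r) (by linarith [hr.2]), wave_pt φ hφ]
    simp only [hK']
    have hs : IsSymmSndFDerivAt ℝ φ (t - r, x + r • (ω : E3)) :=
      hφ.contDiffAt.isSymmSndFDerivAt (by simp)
    have s1 := hs (0, (ω : E3)) (1, 0)
    have v1 : ((-1, (ω : E3)) : ℝ × E3) = (0, (ω : E3)) - (1, 0) := by simp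
    have v2 : ((1, (ω : E3)) : ℝ × E3) = (0, (ω : E3)) + (1, 0) := by simp
    rw [v1, v2]
    simp only [map_sub, map_add, FunLike.coe_sub, Pi.sub_apply]
    rw [s1]
    ring
  rw [setIntegral_congr_fun measurableSet_Ioo e, integral_neg] at ftc
  have g0 : ∫ ω : sphere (0 : E3) 1, K 0 ω ∂sphMeasure = 4 * π * φ (t, x) := by
    simp [hK, sph_mass]
  have gt : ∫ ω : sphere (0 : E3) 1, K t ω ∂sphMeasure = ∫ ω : sphere (0 : E3) 1, (φ (0, x + t • (ω : E3))
        + t * fderiv ℝ φ (0, x + t • (ω : E3)) (1, ω)) ∂sphMeasure := by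
    simp [hK]
  rw [g0, gt] at ftc
  linarith

lemma polar (h : E3 → ℝ) (hh : Integrable h) :
    ∫ y, h y = ∫ r in Set.Ioi (0:ℝ), r ^ 2 * ∫ ω : sphere (0 : E3) 1, h (r • (ω : E3)) ∂sphMeasure := by
  have hd : Module.finrank ℝ E3 - 1 = 2 := by simp
  have mp := (volume : Measure E3).measurePreserving_homeomorphUnitSphereProd
  rw [hd] at mp
  have hemb := (homeomorphUnitSphereProd E3).measurableEmbedding
  let H : sphere (0 : E3) 1 × Set.Ioi (0:ℝ) → ℝ := fun q => h ((q.2 : ℝ) • (q.1 : E3))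
  have hH : ∀ y : ({0}ᶜ : Set E3), H (homeomorphUnitSphereProd E3 y) = h y := by
    intro y
    have := congrArg Subtype.val ((homeomorphUnitSphereProd E3).symm_apply_apply y)
    simp only [H]
    congr 1
  have hint : Integrable H (sphMeasure.prod (.volumeIoiPow 2)) := by
    refine (mp.integrable_comp_emb hemb).1 ?_
    have : H ∘ (homeomorphUnitSphereProd E3) = h ∘ Subtype.val := by ext y; exact hH y
    rw [this, ← integrableOn_iff_comap_subtypeVal (measurableSet_singleton _).compl]
    exact hh.integrableOn
  calc ∫ y, h y = ∫ y : ({(0)}ᶜ : Set E3), h y ∂(volume.comap Subtype.val) := by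
        rw [integral_subtype_comap (measurableSet_singleton _).compl fun x ↦ h x,
          restrict_compl_singleton]
    _ = ∫ q, H q ∂(sphMeasure.prod (.volumeIoiPow 2)) := by
        simp_rw [← hH]
        exact mp.integral_comp hemb H
    _ = ∫ r : Set.Ioi (0 : ℝ), (∫ ω : sphere (0 : E3) 1, h ((r : ℝ) • (ω : E3)) ∂sphMeasure)
          ∂.volumeIoiPow 2 := integral_prod_symm _ hint
    _ = _ := by
      simp only [Measure.volumeIoiPow, ENNReal.ofReal]
      rw [integral_withDensity_eq_integral_smul,
        integral_subtype_comap measurableSet_Ioi fun a ↦ Real.toNNReal (a ^ 2) • 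
          ∫ ω : sphere (0 : E3) 1, h (a • (ω : E3)) ∂sphMeasure,
        setIntegral_congr_fun measurableSet_Ioi fun x hx ↦ ?_]
      · rw [NNReal.smul_def, Real.coe_toNNReal _ (by positivity), smul_eq_mul]
      · exact (measurable_subtype_coe.pow_const _).real_toNNReal

lemma ball_polar (ψ : ℝ × E3 → ℝ) (hψ : Continuous ψ) (t : ℝ) (x : E3) :
    ∫ y in ball x t, ψ (t - ‖y - x‖, y) / ‖y - x‖ =
     ∫ r in Set.Ioo 0 t, r * ∫ ω : sphere (0 : E3) 1,
        ψ (t - r, x + r • (ω : E3)) ∂sphMeasure := by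
  let h : E3 → ℝ := fun z => (ball (0 : E3) t).indicator (fun z => ψ (t - ‖z‖, x + z) / ‖z‖) z
  have hc : Continuous (fun z : E3 => ψ (t - ‖z‖, x + z)) := by fun_prop
  have hint : Integrable h := by
    refine (integrable_indicator_iff measurableSet_ball).2 ?_
    obtain ⟨C, hC⟩ := (isCompact_closedBall (0 : E3) t).exists_bound_of_continuousOn hc.continuousOn
    have hb : IntegrableOn (fun z : E3 => C * (1 / ‖z‖)) (ball 0 t) := by
      refine Integrable.const_mul ?_ C
      refine (integrableOn_fun_norm_addHaar volume (f := fun r => 1 / r)).2 ?_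
      have : IntegrableOn (fun r : ℝ => r) (Set.Ioo 0 t) :=
        (continuous_id.integrableOn_Icc).mono_set Set.Ioo_subset_Icc_self
      refine this.congr_fun (fun r hr => ?_) measurableSet_Ioo
      have := hr.1.ne'
      simp
      field_simp
    refine Integrable.mono' hb ?_ ?_
    · exact (hc.measurable.div measurable_norm).aestronglyMeasurable
    · filter_upwards [ae_restrict_mem measurableSet_ball] with z hz
      rw [norm_div, norm_norm, mul_one_div]
      have := hC z (ball_subset_closedBall hz)
      gcongr
  have hz1 : ∀ z, ‖z‖ < t → h z = ψ (t - ‖z‖, x + z) / ‖z‖ := fun z hz =>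
    Set.indicator_of_mem (s := ball (0 : E3) t) (by simpa using hz) _
  have hz2 : ∀ z, ¬ ‖z‖ < t → h z = 0 := fun z hz =>
    Set.indicator_of_notMem (s := ball (0 : E3) t) (by simpa using hz) _
  calc ∫ y in ball x t, ψ (t - ‖y - x‖, y) / ‖y - x‖
      = ∫ y, h (y - x) := by
        rw [← integral_indicator measurableSet_ball]
        congr 1
        ext y
        by_cases hy : ‖y - x‖ < t
        · rw [hz1 _ hy, Set.indicator_of_mem (by simpa [dist_eq_norm] using hy), add_sub_cancel]
        · rw [hz2 _ hy, Set.indicator_of_notMem (by simpa [dist_eq_norm] using hy)]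
    _ = ∫ z, h z := integral_sub_right_eq_self h x
    _ = _ := by
      rw [polar h hint, ← integral_indicator measurableSet_Ioi, ← integral_indicator measurableSet_Ioo]
      congr 1
      ext r
      by_cases h0 : 0 < r
      · have hn : ∀ ω : sphere (0 : E3) 1, ‖r • (ω : E3)‖ = r := fun ω => by
          simp [norm_smul, abs_of_pos h0]
        by_cases h1 : r < t
        · rw [Set.indicator_of_mem (show r ∈ Set.Ioi 0 from h0),
            Set.indicator_of_mem (show r ∈ Set.Ioo 0 t from ⟨h0, h1⟩)]
          have : ∀ ω : sphere (0 : E3) 1, h (r • (ω : E3)) = ψ (t - r, x + r • (ω : E3)) / r := by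
            intro ω
            rw [hz1 _ (by rw [hn]; exact h1), hn]
          simp_rw [this]
          rw [integral_div]
          field_simp
        · rw [Set.indicator_of_mem (show r ∈ Set.Ioi 0 from h0),
            Set.indicator_of_notMem (fun h' : r ∈ Set.Ioo 0 t => h1 h'.2)]
          have : ∀ ω : sphere (0 : E3) 1, h (r • (ω : E3)) = 0 := by
            intro ω
            rw [hz2 _ (by rw [hn]; exact h1)]
          simp [this]
      · simp [h0]

/-- **Full representation formula for the wave equation in `ℝ^{1+3}`.**  If
`φ ∈ C^∞(ℝ × ℝ³)` solves `∂_t² φ − Δφ = ψ` on `[0,∞) × ℝ³` with initial data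
`φ(0,·) = α₀`, `∂_t φ(0,·) = α₁`, then for every `t > 0` and `x ∈ ℝ³`,
`φ(t,x) = (1/(4π)) ∫_{B(x,t)} ψ(t − |y−x|, y)/|y−x| dy`
`+ (1/(4πt²)) ∫_{∂B(x,t)} [ t α₁(y) + α₀(y) + ⟨y − x, ∇α₀(y)⟩ ] dσ(y)`. -/
theorem wave_representation_formula
    (α₀ α₁ : E3 → ℝ) (ψ φ : ℝ × E3 → ℝ)
    (hα₀ : ContDiff ℝ (⊤ : ℕ∞) α₀) (hα₁ : ContDiff ℝ (⊤ : ℕ∞) α₁)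
    (hψ : ContDiff ℝ (⊤ : ℕ∞) ψ) (hφ : ContDiff ℝ (⊤ : ℕ∞) φ)
    (hwave : ∀ t : ℝ, 0 ≤ t → ∀ x : E3,
      dt (dt φ) (t, x) - lap (fun y => φ (t, y)) x = ψ (t, x))
    (hinit₀ : ∀ x : E3, φ (0, x) = α₀ x)
    (hinit₁ : ∀ x : E3, dt φ (0, x) = α₁ x) :
    ∀ t : ℝ, 0 < t → ∀ x : E3,
      φ (t, x) = (1 / (4 * π)) *
          (∫ y in ball x t, ψ (t - ‖y - x‖, y) / ‖y - x‖)
        + (1 / (4 * π * t ^ 2)) *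
          sphereIntegral x t (fun y => t * α₁ y + α₀ y + ⟪y - x, gradient α₀ y⟫) := by
  intro t ht x
  have hφ2 : ContDiff ℝ 2 φ := hφ.of_le (by exact WithTop.coe_le_coe.2 (le_top : (2 : ℕ∞) ≤ ⊤))
  have key := wave_char φ ψ hφ2 hwave t ht x
  rw [ball_polar ψ hψ.continuous, sphereIntegral]
  have hd : Differentiable ℝ φ := hφ2.differentiable (by norm_num)
  have e : ∀ ω : sphere (0 : E3) 1, φ (0, x + t • (ω : E3))
        + t * fderiv ℝ φ (0, x + t • (ω : E3)) (1, ω) =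
      t * α₁ (x + t • (ω : E3)) + α₀ (x + t • (ω : E3))
        + ⟪x + t • (ω : E3) - x, gradient α₀ (x + t • (ω : E3))⟫ := by
    intro ω
    generalize hy : x + t • (ω : E3) = y
    have hyx : y - x = t • (ω : E3) := by rw [← hy]; simp
    have a1 : α₁ y = fderiv ℝ φ (0, y) (1, 0) := by
      rw [← hinit₁]
      have hB : HasDerivAt (fun s : ℝ => ((s, y) : ℝ × E3)) (1, 0) 0 :=
        (hasDerivAt_id 0).prodMk (hasDerivAt_const 0 y)
      exact ((hd (0, y)).hasFDerivAt.comp_hasDerivAt (0:ℝ) hB).deriv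
    have a0 : fderiv ℝ α₀ y = (fderiv ℝ φ (0, y)).comp (ContinuousLinearMap.inr ℝ ℝ E3) := by
      have : α₀ = fun y => φ (0, y) := by ext y; exact (hinit₀ y).symm
      rw [this]
      exact ((hd (0, y)).hasFDerivAt.comp y (hasFDerivAt_prodMk_right (0:ℝ) y)).fderiv
    rw [hyx, real_inner_smul_left, real_inner_comm, gradient, InnerProductSpace.toDual_symm_apply,
      a0, a1, hinit₀]
    have v2 : ((1, (ω : E3)) : ℝ × E3) = (0, (ω : E3)) + (1, 0) := by simp
    rw [v2, map_add, ContinuousLinearMap.comp_apply, ContinuousLinearMap.inr_apply]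
    ring
  simp_rw [e] at key
  have hpi := Real.pi_pos.ne'
  field_simp
  linarith

end
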